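/- The following rules are derivable in every display calculus DKtP: (ρ1) X ⊢ *•*Y is derivable from *•*X ⊢ Y and vice versa; (ρ2) X ⊢ •(Y∘Z) is derivable from X ⊢ •Y ∘ •Z; (ρ3) X ⊢ *•*(Y∘Z) is derivable from X ⊢ *•*Y ∘ *•*Z; (ρ4) •(X∘Y m) ⊢ Z, i.e. •(X∘Y) ⊢ Z, is derivable from •X ∘ •Y ⊢ Z; (ρ5) *•*(X∘Y) ⊢ Z is derivable from *•*X ∘ *•*Y ⊢ Z. -/

import Mathlib

set_option linter.unusedVariables false

/-- Formulae of the tense language `L`. -/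
inductive Fm : Type where
  | atom : Nat → Fm
  | top : Fm
  | bot : Fm
  | neg : Fm → Fm
  | or : Fm → Fm → Fm
  | and : Fm → Fm → Fm
  | imp : Fm → Fm → Fm
  | box : Fm → Fm
  | dia : Fm → Fm
  | boxP : Fm → Fm
  | diaP : Fm → Fm
deriving DecidableEq

instance : Inhabited Fm := ⟨Fm.top⟩

/-- The language `L_{∧,◇,♦}`. -/
inductive SimpFm : Fm → Prop where
  | atom (p : Nat) : SimpFm (.atom p)
  | top : SimpFm .top
  | and {A B : Fm} : SimpFm A → SimpFm B → SimpFm (.and A B)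
  | dia {A : Fm} : SimpFm A → SimpFm (.dia A)
  | diaP {A : Fm} : SimpFm A → SimpFm (.diaP A)

/-- The grammar `A ::= p | ⊤ | (A∧A) | (A∨A) | ◇A | ♦A` of primitive tense axioms. -/
inductive PrimFm : Fm → Prop where
  | atom (p : Nat) : PrimFm (.atom p)
  | top : PrimFm .top
  | and {A B : Fm} : PrimFm A → PrimFm B → PrimFm (.and A B)
  | or {A B : Fm} : PrimFm A → PrimFm B → PrimFm (.or A B)
  | dia {A : Fm} : PrimFm A → PrimFm (.dia A)
  | diaP {A : Fm} : PrimFm A → PrimFm (.diaP A)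

/-- Number of occurrences of the atom `p` in a formula. -/
def atomCount : Fm → Nat → Nat
  | .atom q, p => if q = p then 1 else 0
  | .top, _ => 0
  | .bot, _ => 0
  | .neg A, p => atomCount A p
  | .or A B, p => atomCount A p + atomCount B p
  | .and A B, p => atomCount A p + atomCount B p
  | .imp A B, p => atomCount A p + atomCount B p
  | .box A, p => atomCount A p
  | .dia A, p => atomCount A p
  | .boxP A, p => atomCount A p
  | .diaP A, p => atomCount A p

/-- `A` contains each propositional atom at most once. -/
def AtomsOnce (A : Fm) : Prop := ∀ p, atomCount A p ≤ 1

/-- A simplified primitive tense axiom, encoded as its antecedent together with the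
(nonempty) list of its disjuncts. -/
def ValidAx (x : Fm × List Fm) : Prop :=
  SimpFm x.1 ∧ AtomsOnce x.1 ∧ x.2 ≠ [] ∧ ∀ B ∈ x.2, SimpFm B

/-- A set of simplified primitive tense axioms. -/
def ValidAxSet (P : Set (Fm × List Fm)) : Prop := ∀ x ∈ P, ValidAx x

/-- Display structures `X ::= A | I | *X | •X | (X∘X)`. -/
inductive Str : Type where
  | fm : Fm → Str
  | I : Str
  | star : Str → Str
  | bullet : Str → Str
  | comp : Str → Str → Str
deriving DecidableEq

/-- Display sequents `X ⊢ Y`. -/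
structure DSeq : Type where
  ant : Str
  suc : Str
deriving DecidableEq

/-- Length of a structure. -/
def Str.len : Str → Nat
  | .fm _ => 1
  | .I => 1
  | .star X => X.len + 1
  | .bullet X => X.len + 1
  | .comp X Y => X.len + Y.len + 1

/-- Length of a display sequent. -/
def DSeq.len (d : DSeq) : Nat := d.ant.len + d.suc.len

/-- The translation `ψ` from formulae of `L_{∧,◇,♦}` to (schematic) structures, where the
structure variable `Ẋ_p` for each atom `p` is instantiated by `θ p`. -/
def psiStr (θ : Nat → Str) : Fm → Str
  | .atom p => θ p
  | .top => .I
  | .and A B => .comp (psiStr θ A) (psiStr θ B)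
  | .dia A => .star (.bullet (.star (psiStr θ A)))
  | .diaP A => .bullet (psiStr θ A)
  | _ => .I

/-- The rules of Kracht's display calculus `DKtP` for the primitive tense logic
axiomatized by the set `P` of simplified primitive tense axioms, given as a relation
between the list of premises and the conclusion. -/
inductive DRule (P : Set (Fm × List Fm)) : List DSeq → DSeq → Prop where
  | id (p : Nat) : DRule P [] ⟨.fm (.atom p), .fm (.atom p)⟩
  | topR : DRule P [] ⟨.I, .fm .top⟩
  | botL : DRule P [] ⟨.fm .bot, .I⟩
  | topL (Y : Str) : DRule P [⟨.I, Y⟩] ⟨.fm .top, Y⟩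
  | botR (X : Str) : DRule P [⟨X, .I⟩] ⟨X, .fm .bot⟩
  | negL (A : Fm) (Y : Str) : DRule P [⟨.star (.fm A), Y⟩] ⟨.fm (.neg A), Y⟩
  | negR (A : Fm) (X : Str) : DRule P [⟨X, .star (.fm A)⟩] ⟨X, .fm (.neg A)⟩
  | impR (A B : Fm) (X : Str) : DRule P [⟨.comp X (.fm A), .fm B⟩] ⟨X, .fm (.imp A B)⟩
  | impL (A B : Fm) (X Y : Str) :
      DRule P [⟨X, .fm A⟩, ⟨.fm B, Y⟩] ⟨.fm (.imp A B), .comp (.star X) Y⟩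
  | orR (A B : Fm) (X : Str) : DRule P [⟨X, .comp (.fm A) (.fm B)⟩] ⟨X, .fm (.or A B)⟩
  | orL (A B : Fm) (Y : Str) : DRule P [⟨.fm A, Y⟩, ⟨.fm B, Y⟩] ⟨.fm (.or A B), Y⟩
  | andL (A B : Fm) (Y : Str) : DRule P [⟨.comp (.fm A) (.fm B), Y⟩] ⟨.fm (.and A B), Y⟩
  | andR (A B : Fm) (X : Str) : DRule P [⟨X, .fm A⟩, ⟨X, .fm B⟩] ⟨X, .fm (.and A B)⟩
  | boxL (A : Fm) (Y : Str) : DRule P [⟨.fm A, Y⟩] ⟨.fm (.box A), .bullet Y⟩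
  | boxR (A : Fm) (X : Str) : DRule P [⟨.bullet X, .fm A⟩] ⟨X, .fm (.box A)⟩
  | diaL (A : Fm) (Y : Str) :
      DRule P [⟨.fm A, .star (.bullet (.star Y))⟩] ⟨.fm (.dia A), Y⟩
  | diaR (A : Fm) (X : Str) :
      DRule P [⟨X, .fm A⟩] ⟨.star (.bullet (.star X)), .fm (.dia A)⟩
  | boxPR (A : Fm) (X : Str) :
      DRule P [⟨.star (.bullet (.star X)), .fm A⟩] ⟨X, .fm (.boxP A)⟩
  | boxPL (A : Fm) (Y : Str) :
      DRule P [⟨.fm A, Y⟩] ⟨.fm (.boxP A), .star (.bullet (.star Y))⟩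
  | diaPL (A : Fm) (Y : Str) : DRule P [⟨.fm A, .bullet Y⟩] ⟨.fm (.diaP A), Y⟩
  | diaPR (A : Fm) (X : Str) : DRule P [⟨X, .fm A⟩] ⟨.bullet X, .fm (.diaP A)⟩
  | d1a (X Y Z : Str) : DRule P [⟨.comp X Y, Z⟩] ⟨X, .comp Z (.star Y)⟩
  | d1b (X Y Z : Str) : DRule P [⟨X, .comp Z (.star Y)⟩] ⟨.comp X Y, Z⟩
  | d2a (X Y Z : Str) : DRule P [⟨.comp X Y, Z⟩] ⟨Y, .comp (.star X) Z⟩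
  | d2b (X Y Z : Str) : DRule P [⟨Y, .comp (.star X) Z⟩] ⟨.comp X Y, Z⟩
  | d3a (X Y Z : Str) : DRule P [⟨X, .comp Y Z⟩] ⟨.comp X (.star Z), Y⟩
  | d3b (X Y Z : Str) : DRule P [⟨.comp X (.star Z), Y⟩] ⟨X, .comp Y Z⟩
  | d4a (X Y Z : Str) : DRule P [⟨X, .comp Y Z⟩] ⟨.comp (.star Y) X, Z⟩
  | d4b (X Y Z : Str) : DRule P [⟨.comp (.star Y) X, Z⟩] ⟨X, .comp Y Z⟩
  | d5a (X Y : Str) : DRule P [⟨.star X, Y⟩] ⟨.star Y, X⟩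
  | d5b (X Y : Str) : DRule P [⟨.star Y, X⟩] ⟨.star X, Y⟩
  | d6a (X Y : Str) : DRule P [⟨X, .star Y⟩] ⟨Y, .star X⟩
  | d6b (X Y : Str) : DRule P [⟨Y, .star X⟩] ⟨X, .star Y⟩
  | d7a (X Y : Str) : DRule P [⟨.star (.star X), Y⟩] ⟨X, Y⟩
  | d7b (X Y : Str) : DRule P [⟨X, Y⟩] ⟨.star (.star X), Y⟩
  | d8a (X Y : Str) : DRule P [⟨X, .star (.star Y)⟩] ⟨X, Y⟩
  | d8b (X Y : Str) : DRule P [⟨X, Y⟩] ⟨X, .star (.star Y)⟩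
  | d9a (X Y : Str) : DRule P [⟨X, .bullet Y⟩] ⟨.bullet X, Y⟩
  | d9b (X Y : Str) : DRule P [⟨.bullet X, Y⟩] ⟨X, .bullet Y⟩
  | ila (X Y : Str) : DRule P [⟨X, Y⟩] ⟨.comp .I X, Y⟩
  | ilb (X Y : Str) : DRule P [⟨.comp .I X, Y⟩] ⟨X, Y⟩
  | ira (X Y : Str) : DRule P [⟨X, Y⟩] ⟨X, .comp .I Y⟩
  | irb (X Y : Str) : DRule P [⟨X, .comp .I Y⟩] ⟨X, Y⟩
  | qla (Y : Str) : DRule P [⟨.I, Y⟩] ⟨.star .I, Y⟩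
  | qlb (Y : Str) : DRule P [⟨.star .I, Y⟩] ⟨.I, Y⟩
  | qra (X : Str) : DRule P [⟨X, .I⟩] ⟨X, .star .I⟩
  | qrb (X : Str) : DRule P [⟨X, .star .I⟩] ⟨X, .I⟩
  | wl (X Y Z : Str) : DRule P [⟨X, Y⟩] ⟨.comp Z X, Y⟩
  | wr (X Y Z : Str) : DRule P [⟨X, Y⟩] ⟨X, .comp Y Z⟩
  | ala (X Y Z W : Str) : DRule P [⟨.comp X (.comp Y Z), W⟩] ⟨.comp (.comp X Y) Z, W⟩
  | alb (X Y Z W : Str) : DRule P [⟨.comp (.comp X Y) Z, W⟩] ⟨.comp X (.comp Y Z), W⟩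
  | ara (X Y Z W : Str) : DRule P [⟨X, .comp Y (.comp Z W)⟩] ⟨X, .comp (.comp Y Z) W⟩
  | arb (X Y Z W : Str) : DRule P [⟨X, .comp (.comp Y Z) W⟩] ⟨X, .comp Y (.comp Z W)⟩
  | pl (X Y Z : Str) : DRule P [⟨.comp X Y, Z⟩] ⟨.comp Y X, Z⟩
  | pr (X Y Z : Str) : DRule P [⟨X, .comp Y Z⟩] ⟨X, .comp Z Y⟩
  | cl (X Y : Str) : DRule P [⟨.comp X X, Y⟩] ⟨X, Y⟩
  | cr (X Y : Str) : DRule P [⟨X, .comp Y Y⟩] ⟨X, Y⟩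
  | ml (Y : Str) : DRule P [⟨.I, Y⟩] ⟨.bullet .I, Y⟩
  | mr (X : Str) : DRule P [⟨X, .I⟩] ⟨X, .bullet .I⟩
  | cut (A : Fm) (X Y : Str) : DRule P [⟨X, .fm A⟩, ⟨.fm A, Y⟩] ⟨X, Y⟩
  | pt (A : Fm) (Bs : List Fm) (θ : Nat → Str) (X : Str) :
      (A, Bs) ∈ P →
      DRule P (Bs.map (fun B => ⟨psiStr θ B, X⟩)) ⟨psiStr θ A, X⟩

/-- Derivability in the display calculus `DKtP` from a set `H` of hypothesis sequents. -/
inductive DPH (P : Set (Fm × List Fm)) (H : Set DSeq) : DSeq → Prop where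
  | hyp {d : DSeq} : d ∈ H → DPH P H d
  | node {prems : List DSeq} {concl : DSeq} :
      DRule P prems concl → (∀ p ∈ prems, DPH P H p) → DPH P H concl

namespace DPH

variable {P : Set (Fm × List Fm)} {H : Set DSeq}

/-- Application of a one-premise rule. -/
theorem unary {d e : DSeq} (r : DRule P [d] e) (h : DPH P H d) : DPH P H e :=
  node r fun p hp => by
    rw [List.mem_singleton.mp hp]
    exact h

theorem bullet_iff {X Y : Str} : DPH P H ⟨.bullet X, Y⟩ ↔ DPH P H ⟨X, .bullet Y⟩ :=
  ⟨unary (.d9b _ _), unary (.d9a _ _)⟩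

/-- The structural operator `*•*` is adjoint to itself. -/
theorem star_bullet_star_iff {X Y : Str} :
    DPH P H ⟨.star (.bullet (.star X)), Y⟩ ↔ DPH P H ⟨X, .star (.bullet (.star Y))⟩ :=
  ⟨fun h => unary (.d6a _ _) (unary (.d9a _ _) (unary (.d5a _ _) h)),
    fun h => unary (.d5a _ _) (unary (.d9b _ _) (unary (.d6a _ _) h))⟩

/-- A self-adjoint structural operator can be pulled out of a composition in the antecedent. -/
theorem antecedent_comp {f : Str → Str}
    (adj : ∀ U V, DPH P H ⟨f U, V⟩ ↔ DPH P H ⟨U, f V⟩) {X Y Z : Str}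
    (h : DPH P H ⟨.comp (f X) (f Y), Z⟩) : DPH P H ⟨f (.comp X Y), Z⟩ := by
  have h₁ : DPH P H ⟨f (.comp X Y), .comp Z (.star (f Y))⟩ :=
    (adj _ _).mpr (unary (.pl _ _ _) (unary (.wl _ _ _) ((adj _ _).mp (unary (.d1a _ _ _) h))))
  have h₂ : DPH P H ⟨f (.comp X Y), .comp (.star (f (.comp X Y))) Z⟩ :=
    (adj _ _).mpr (unary (.wl _ _ _) ((adj _ _).mp (unary (.d2a _ _ _) (unary (.d1b _ _ _) h₁))))
  exact unary (.cl _ _) (unary (.d2b _ _ _) h₂)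

/-- A self-adjoint structural operator can be pulled out of a composition in the succedent. -/
theorem succedent_comp {f : Str → Str}
    (adj : ∀ U V, DPH P H ⟨f U, V⟩ ↔ DPH P H ⟨U, f V⟩) {X Y Z : Str}
    (h : DPH P H ⟨X, .comp (f Y) (f Z)⟩) : DPH P H ⟨X, f (.comp Y Z)⟩ := by
  have h₁ : DPH P H ⟨.comp X (.star (f Z)), f (.comp Y Z)⟩ :=
    (adj _ _).mp (unary (.wr _ _ _) ((adj _ _).mpr (unary (.d3a _ _ _) h)))
  have h₂ : DPH P H ⟨.comp (.star (f (.comp Y Z))) X, f (.comp Y Z)⟩ :=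
    (adj _ _).mp (unary (.pr _ _ _) (unary (.wr _ _ _)
      ((adj _ _).mpr (unary (.d4a _ _ _) (unary (.d3b _ _ _) h₁)))))
  exact unary (.cr _ _) (unary (.d4b _ _ _) h₂)

end DPH

/-- The rules `(ρ1)`–`(ρ5)` are derivable in every display calculus
`DKtP` (with `(ρ1)` derivable in both directions). -/
theorem derivable_rules_rho (P : Set (Fm × List Fm)) (hP : ValidAxSet P) (X Y Z : Str) :
    (DPH P {⟨.star (.bullet (.star X)), Y⟩} ⟨X, .star (.bullet (.star Y))⟩ ∧
     DPH P {⟨X, .star (.bullet (.star Y))⟩} ⟨.star (.bullet (.star X)), Y⟩) ∧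
    DPH P {⟨X, .comp (.bullet Y) (.bullet Z)⟩} ⟨X, .bullet (.comp Y Z)⟩ ∧
    DPH P {⟨X, .comp (.star (.bullet (.star Y))) (.star (.bullet (.star Z)))⟩}
      ⟨X, .star (.bullet (.star (.comp Y Z)))⟩ ∧
    DPH P {⟨.comp (.bullet X) (.bullet Y), Z⟩} ⟨.bullet (.comp X Y), Z⟩ ∧
    DPH P {⟨.comp (.star (.bullet (.star X))) (.star (.bullet (.star Y))), Z⟩}
      ⟨.star (.bullet (.star (.comp X Y))), Z⟩ := by
  exact ⟨⟨DPH.star_bullet_star_iff.mp (.hyp rfl), DPH.star_bullet_star_iff.mpr (.hyp rfl)⟩,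
    DPH.succedent_comp (fun _ _ => DPH.bullet_iff) (.hyp rfl),
    DPH.succedent_comp (f := fun W => .star (.bullet (.star W)))
      (fun _ _ => DPH.star_bullet_star_iff) (.hyp rfl),
    DPH.antecedent_comp (fun _ _ => DPH.bullet_iff) (.hyp rfl),
    DPH.antecedent_comp (f := fun W => .star (.bullet (.star W)))
      (fun _ _ => DPH.star_bullet_star_iff) (.hyp rfl)⟩
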